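/- arXiv:1407.3200 — 2 statements merged into one kernel-verified Lean document; each statement's English description precedes it below -/
import Mathlib

section
/- There exist constants c > 0 and n_0 such that for every integer n ≥ n_0 there is a finite connected undirected graph G with at most n vertices and m edges, together with an initial rotor-router state S_0 carrying k = 2m tokens, whose periodicity satisfies t_p ≥ 2^{c·√(n·log n)}. -/
open Finset

namespace RotorRouter

variable {V : Type} [Fintype V] [DecidableEq V] (G : SimpleGraph V) [DecidableRel G.Adj]

/-- The outgoing arcs (darts) of a vertex `v`. -/
def outArcs (v : V) : Finset G.Dart := Finset.univ.filter (fun d => d.fst = v)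

/-- The incoming arcs (darts) of a vertex `v`. -/
def inArcs (v : V) : Finset G.Dart := Finset.univ.filter (fun d => d.snd = v)

/-- A state of the rotor-router system: at each vertex, the current pointer
(represented as an index, in the fixed cyclic order, of an outgoing arc) and the
number of tokens currently located at the vertex. -/
structure State where
  ptr : V → ℕ
  tokens : V → ℕ
  ptr_lt : ∀ v : V, 0 < G.degree v → ptr v < G.degree v

variable (ord : ∀ v : V, Fin (G.degree v) ≃ {d : G.Dart // d.fst = v})

/-- The number of tokens sent out on the `j`-th outgoing arc when `k` tokens leave a
vertex of degree `deg` in round-robin fashion, starting from pointer position `p`. -/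
def sentCount (deg p k j : ℕ) : ℕ :=
  ((Finset.range k).filter (fun i => (p + i) % deg = j)).card

/-- The number of tokens sent along the arc `d` during one step from state `S`. -/
def arcLoad (S : State G) (d : G.Dart) : ℕ :=
  sentCount (G.degree d.fst) (S.ptr d.fst) (S.tokens d.fst)
    (((ord d.fst).symm ⟨d, rfl⟩ : Fin (G.degree d.fst)) : ℕ)

/-- One synchronous step of the rotor-router system: every vertex sends out all of its
tokens in round-robin fashion, advancing its pointer after each token. -/
def step (S : State G) : State G where
  ptr v := if 0 < G.degree v then (S.ptr v + S.tokens v) % G.degree v else S.ptr v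
  tokens v := (∑ d ∈ inArcs G v, arcLoad G ord S d) +
    (if 0 < G.degree v then 0 else S.tokens v)
  ptr_lt v h := by simp only [if_pos h]; exact Nat.mod_lt _ h

/-- `evol S0 t` is the state `S_t` reached after `t` steps from the initial state `S0`. -/
def evol (S0 : State G) (t : ℕ) : State G := (step G ord)^[t] S0

/-- `load S0 t d` is `L_t(d)`, the number of tokens sent along arc `d` during step `t`. -/
def load (S0 : State G) (t : ℕ) (d : G.Dart) : ℕ := arcLoad G ord (evol G ord S0 t) d

/-- `cum S0 t1 t2 d` is the cumulative load `C_{t1}^{t2}(d) = Σ_{t1 ≤ t < t2} L_t(d)`. -/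
def cum (S0 : State G) (t1 t2 : ℕ) (d : G.Dart) : ℕ :=
  ∑ t ∈ Finset.Ico t1 t2, load G ord S0 t d

/-- `cumV S0 t1 t2 v` is the cumulative vertex load `C_{t1}^{t2}(v)`. -/
def cumV (S0 : State G) (t1 t2 : ℕ) (v : V) : ℕ :=
  ∑ t ∈ Finset.Ico t1 t2, (evol G ord S0 t).tokens v

/-- `pot S0 i t` is the `i`-th potential `Φ_i(S_t) = Σ_{e} (C_t^{t+i}(e))²`. -/
def pot (S0 : State G) (i t : ℕ) : ℕ := ∑ d : G.Dart, (cum G ord S0 t (t + i) d) ^ 2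

/-- A state `S_t` is stable if it repeats: `S_{t'} = S_t` for some `t' > t`. -/
def IsStable (S0 : State G) (t : ℕ) : Prop :=
  ∃ t' > t, evol G ord S0 t' = evol G ord S0 t

/-- A family of bijections `in(v) → out(v)` (encoded as a global bijection `M` on darts
with `(M d).fst = d.snd`) is valid w.r.t. the `Δt`-step subcycle decomposition of `S_T`
if `L_t(e) = L_{t+1}(M e)` for all arcs `e` and all `T ≤ t < T + Δt`. -/
def ValidMapping (S0 : State G) (T Δt : ℕ) (M : G.Dart → G.Dart) : Prop :=
  Function.Bijective M ∧ (∀ d : G.Dart, (M d).fst = d.snd) ∧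
    ∀ (d : G.Dart) (t : ℕ), T ≤ t → t < T + Δt →
      load G ord S0 t d = load G ord S0 (t + 1) (M d)

/-- `S_T` admits a `Δt`-step subcycle decomposition. -/
def HasSubcycleDecomp (S0 : State G) (T Δt : ℕ) : Prop :=
  ∃ M : G.Dart → G.Dart, ValidMapping G ord S0 T Δt M


/-- A rotor-router system: a finite connected undirected graph together with a fixed
cyclic ordering of the outgoing arcs at every vertex. -/
structure System where
  V : Type
  [fin : Fintype V]
  [deq : DecidableEq V]
  G : SimpleGraph V
  [adj : DecidableRel G.Adj]
  conn : G.Connected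
  ord : ∀ v : V, Fin (G.degree v) ≃ {d : G.Dart // d.fst = v}

attribute [instance] System.fin System.deq System.adj

/-- The stabilization time of `S0`: the least `t` such that `S_t` is stable. -/
noncomputable def stabTime (S0 : State G) : ℕ := sInf {t : ℕ | IsStable G ord S0 t}

/-- The periodicity of `S0`: the least `t_p > 0` with `S_{t_s + t_p} = S_{t_s}`. -/
noncomputable def period (S0 : State G) : ℕ :=
  sInf {p : ℕ | 0 < p ∧
    evol G ord S0 (stabTime G ord S0 + p) = evol G ord S0 (stabTime G ord S0)}

set_option linter.unusedSectionVars false in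
theorem State.eq_of {S T : State G} (h1 : S.ptr = T.ptr) (h2 : S.tokens = T.tokens) : S = T := by
  cases S; cases T; cases h1; cases h2; rfl

theorem sentCount_near_degree {deg a b j : ℕ} (hdeg : 2 ≤ deg) (ha : a ≤ 1) (hb : b ≤ 1)
    (hj : j < deg) :
    sentCount deg b (deg + a - b) j = if j = 0 then 1 + a - b else 1 := by
  have key : ∀ i, i ≤ deg → i % deg = if i = deg then 0 else i := by
    intro i hi
    split_ifs with h
    · rw [h, Nat.mod_self]
    · exact Nat.mod_eq_of_lt (by omega)
  unfold sentCount
  by_cases h0 : j = 0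
  · subst h0
    have : ((range (deg + a - b)).filter fun i => (b + i) % deg = 0) =
        (range (1 - b)) ∪ Ico (deg - b) (deg + a - b) := by
      ext i
      simp only [mem_filter, mem_range, mem_union, mem_Ico]
      constructor
      · rintro ⟨h1, h2⟩
        rw [key _ (by omega)] at h2
        split_ifs at h2 <;> omega
      · intro h
        refine ⟨by omega, ?_⟩
        rw [key _ (by omega)]
        split_ifs <;> omega
    rw [this, card_union_of_disjoint, card_range, Nat.card_Ico, if_pos rfl]
    · omega
    · rw [disjoint_left]
      intro i
      simp only [mem_range, mem_Ico]
      omega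
  · rw [if_neg h0, card_eq_one]
    refine ⟨j - b, ?_⟩
    ext i
    simp only [mem_filter, mem_range, mem_singleton]
    constructor
    · rintro ⟨h1, h2⟩
      rw [key _ (by omega)] at h2
      split_ifs at h2 <;> omega
    · intro h
      refine ⟨by omega, ?_⟩
      rw [key _ (by omega)]
      split_ifs <;> omega

/-- Given a permutation `σ` of the vertices and a 0-1 valued function `f`, the state in which the
vertex `v` carries `deg v + f v - f (σ v)` tokens and has its pointer at position `f (σ v)`.
When position `0` at `v` is the arc from `v` to `σ v`, the step function moves `f` along `σ`. -/
def rotState (hdeg : ∀ v, 2 ≤ G.degree v) (σ : Equiv.Perm V) (f : V → ℕ) (hf : ∀ v, f v ≤ 1) :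
    State G where
  ptr v := f (σ v)
  tokens v := G.degree v + f v - f (σ v)
  ptr_lt v _ := (hf (σ v)).trans_lt (hdeg v)

theorem card_inArcs (v : V) : (inArcs G v).card = G.degree v := by
  rw [← G.dart_fst_fiber_card_eq_degree v]
  refine card_bij (fun d _ => d.symm) ?_ ?_ ?_
  · intro d hd
    simpa [inArcs] using hd
  · intro a _ b _ h
    exact SimpleGraph.Dart.symm_involutive.injective h
  · intro d hd
    exact ⟨d.symm, by simpa [inArcs] using hd, d.symm_symm⟩

set_option linter.unusedSectionVars false in
theorem sum_tokens_rotState (hdeg : ∀ v, 2 ≤ G.degree v) (σ : Equiv.Perm V) (f : V → ℕ)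
    (hf : ∀ v, f v ≤ 1) :
    ∑ v, (rotState G hdeg σ f hf).tokens v = 2 * G.edgeFinset.card := by
  rw [← G.sum_degrees_eq_twice_card_edges]
  have h1 : ∑ v, ((rotState G hdeg σ f hf).tokens v + f (σ v)) = ∑ v, (G.degree v + f v) := by
    refine sum_congr rfl fun v _ => ?_
    have := hdeg v
    have := hf (σ v)
    simp only [rotState]
    omega
  rw [sum_add_distrib, sum_add_distrib, Equiv.sum_comp σ f] at h1
  omega

theorem arcLoad_rotState (hdeg : ∀ v, 2 ≤ G.degree v) (σ : Equiv.Perm V)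
    (hord : ∀ v, (ord v ⟨0, two_pos.trans_le (hdeg v)⟩).1.snd = σ v) (f : V → ℕ)
    (hf : ∀ v, f v ≤ 1) (d : G.Dart) :
    arcLoad G ord (rotState G hdeg σ f hf) d =
      if d.snd = σ d.fst then 1 + f d.fst - f (σ d.fst) else 1 := by
  have h := sentCount_near_degree (hdeg d.fst) (hf d.fst) (hf (σ d.fst))
    ((ord d.fst).symm ⟨d, rfl⟩).2
  refine h.trans ?_
  congr 1
  rw [eq_iff_iff]
  constructor
  · intro h0
    have : (ord d.fst).symm ⟨d, rfl⟩ = ⟨0, two_pos.trans_le (hdeg d.fst)⟩ := Fin.ext h0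
    rw [← hord, ← this, Equiv.apply_symm_apply]
  · intro h0
    have : ord d.fst ⟨0, two_pos.trans_le (hdeg d.fst)⟩ = ⟨d, rfl⟩ := by
      apply Subtype.ext
      apply SimpleGraph.Dart.ext
      apply Prod.ext
      · exact (ord d.fst ⟨0, two_pos.trans_le (hdeg d.fst)⟩).2
      · exact (hord d.fst).trans h0.symm
    rw [← this, Equiv.symm_apply_apply]

theorem step_rotState (hdeg : ∀ v, 2 ≤ G.degree v) (σ : Equiv.Perm V)
    (hord : ∀ v, (ord v ⟨0, two_pos.trans_le (hdeg v)⟩).1.snd = σ v)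
    (hσ : ∀ v, G.Adj v (σ v)) (f : V → ℕ) (hf : ∀ v, f v ≤ 1) :
    step G ord (rotState G hdeg σ f hf) =
      rotState G hdeg σ (fun v => f (σ.symm v)) (fun v => hf (σ.symm v)) := by
  have hpos : ∀ v, 0 < G.degree v := fun v => two_pos.trans_le (hdeg v)
  refine State.eq_of G (funext fun v => ?_) (funext fun v => ?_)
  · have h2 := hdeg v
    have ha := hf v
    have hb := hf (σ v)
    simp only [step, rotState, if_pos (hpos v), Equiv.symm_apply_apply]
    rw [show f (σ v) + (G.degree v + f v - f (σ v)) = f v + G.degree v by omega,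
      Nat.add_mod_right, Nat.mod_eq_of_lt (by omega)]
  · let d₀ : G.Dart := ⟨(σ.symm v, v), by simpa using hσ (σ.symm v)⟩
    have hd₀ : d₀ ∈ inArcs G v := by simp [inArcs, d₀]
    have hrest : ∑ d ∈ (inArcs G v).erase d₀, arcLoad G ord (rotState G hdeg σ f hf) d =
        G.degree v - 1 := by
      rw [← card_inArcs, ← card_erase_of_mem hd₀, card_eq_sum_ones]
      refine sum_congr rfl fun d hd => ?_
      rw [arcLoad_rotState G ord hdeg σ hord, if_neg]
      intro h
      rw [mem_erase, inArcs, mem_filter] at hd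
      apply hd.1
      apply SimpleGraph.Dart.ext
      apply Prod.ext
      · change d.fst = σ.symm v
        rw [← hd.2.2, h, Equiv.symm_apply_apply]
      · exact hd.2.2
    have hload : arcLoad G ord (rotState G hdeg σ f hf) d₀ = 1 + f (σ.symm v) - f v := by
      rw [arcLoad_rotState G ord hdeg σ hord]
      simp [d₀]
    have h2 := hdeg v
    have hb := hf v
    simp only [step, if_pos (hpos v), ← add_sum_erase _ _ hd₀, hrest, hload]
    simp only [rotState, Equiv.symm_apply_apply]
    omega

theorem evol_rotState (hdeg : ∀ v, 2 ≤ G.degree v) (σ : Equiv.Perm V)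
    (hord : ∀ v, (ord v ⟨0, two_pos.trans_le (hdeg v)⟩).1.snd = σ v)
    (hσ : ∀ v, G.Adj v (σ v)) (f : V → ℕ) (hf : ∀ v, f v ≤ 1) (t : ℕ) :
    evol G ord (rotState G hdeg σ f hf) t =
      rotState G hdeg σ (fun v => f ((σ.symm ^ t) v)) (fun v => hf ((σ.symm ^ t) v)) := by
  induction t with
  | zero => rfl
  | succ t ih =>
    rw [evol, Function.iterate_succ_apply', ← evol, ih, step_rotState G ord hdeg σ hord hσ]
    simp only [pow_succ, Equiv.Perm.mul_apply]

/-- If the initial state recurs, the periodicity is bounded below by any lower bound on the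
return times to the initial state. -/
theorem le_period_of_recurrent (S0 : State G) (N : ℕ)
    (hrec : ∃ p, 0 < p ∧ evol G ord S0 p = S0)
    (hN : ∀ p, 0 < p → evol G ord S0 p = S0 → N ≤ p) : N ≤ period G ord S0 := by
  obtain ⟨q, hq, hqS⟩ := hrec
  have hstab : stabTime G ord S0 = 0 := by
    have h0 : (0 : ℕ) ∈ {t : ℕ | IsStable G ord S0 t} := ⟨q, hq, hqS⟩
    exact Nat.le_zero.1 (Nat.sInf_le h0)
  unfold period
  rw [hstab]
  simp only [zero_add]
  exact le_csInf ⟨q, hq, hqS⟩ fun p hp => hN p hp.1 hp.2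

theorem exists_ord_zero (σ : V → V) (hσ : ∀ v, G.Adj v (σ v)) (hpos : ∀ v, 0 < G.degree v) :
    ∃ ord : ∀ v : V, Fin (G.degree v) ≃ {d : G.Dart // d.fst = v},
      ∀ v, (ord v ⟨0, hpos v⟩).1.snd = σ v := by
  have hcard : ∀ v, Fintype.card {d : G.Dart // d.fst = v} = G.degree v := fun v => by
    rw [Fintype.card_subtype, G.dart_fst_fiber_card_eq_degree]
  let e : ∀ v : V, Fin (G.degree v) ≃ {d : G.Dart // d.fst = v} := fun v =>
    (Fintype.equivFinOfCardEq (hcard v)).symm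
  let a : ∀ v, {d : G.Dart // d.fst = v} := fun v => ⟨⟨(v, σ v), hσ v⟩, rfl⟩
  refine ⟨fun v => (e v).trans (Equiv.swap (e v ⟨0, hpos v⟩) (a v)), fun v => ?_⟩
  rw [Equiv.trans_apply, Equiv.swap_apply_left]

section CycleFamily

variable {ι : Type} (n : ι → ℕ)

/-- The permutation of `Σ i, ZMod (n i)` adding `1` in every component. -/
def shift : Equiv.Perm (Σ i, ZMod (n i)) := Equiv.sigmaCongrRight fun _ => Equiv.addRight 1

theorem shift_symm_pow_apply (t : ℕ) (i : ι) (a : ZMod (n i)) :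
    ((shift n).symm ^ t) ⟨i, a⟩ = ⟨i, a - t⟩ := by
  induction t with
  | zero => simp
  | succ t ih =>
    rw [pow_succ', Equiv.Perm.mul_apply, ih, Equiv.symm_apply_eq]
    simp only [shift, Equiv.sigmaCongrRight_apply, Equiv.coe_addRight]
    push_cast
    congr 1
    ring

/-- The disjoint union of cycles of lengths `n i`, with one marked vertex on each cycle and any
two marked vertices joined. -/
def cycleFamily : SimpleGraph (Σ i, ZMod (n i)) :=
  SimpleGraph.fromRel fun x y => y = shift n x ∨ (x.2 = 0 ∧ y.2 = 0)

theorem shift_ne_self (hn : ∀ i, 3 ≤ n i) (x : Σ i, ZMod (n i)) : shift n x ≠ x := by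
  obtain ⟨i, a⟩ := x
  have : Fact (1 < n i) := ⟨by linarith [hn i]⟩
  simp [shift]

theorem shift_shift_ne_self (hn : ∀ i, 3 ≤ n i) (x : Σ i, ZMod (n i)) :
    shift n (shift n x) ≠ x := by
  obtain ⟨i, a⟩ := x
  simp only [shift, Equiv.sigmaCongrRight_apply, Equiv.coe_addRight, ne_eq,
    Sigma.mk.injEq, heq_eq_eq, true_and, add_assoc, add_eq_left]
  intro h
  have h2 : ((2 : ℕ) : ZMod (n i)) = 0 := by push_cast; rw [← h]; norm_num
  rw [ZMod.natCast_eq_zero_iff] at h2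
  have := Nat.le_of_dvd two_pos h2
  have := hn i
  omega

theorem cycleFamily_adj_shift (hn : ∀ i, 3 ≤ n i) (x : Σ i, ZMod (n i)) :
    (cycleFamily n).Adj x (shift n x) := by
  rw [cycleFamily, SimpleGraph.fromRel_adj]
  exact ⟨(shift_ne_self n hn x).symm, Or.inl (Or.inl rfl)⟩

theorem two_le_degree_cycleFamily (hn : ∀ i, 3 ≤ n i) (x : Σ i, ZMod (n i))
    [Fintype ((cycleFamily n).neighborSet x)] : 2 ≤ (cycleFamily n).degree x := by
  classical
  rw [← SimpleGraph.card_neighborFinset_eq_degree]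
  have hne : shift n x ≠ (shift n).symm x := by
    intro h
    apply shift_shift_ne_self n hn x
    rw [h, Equiv.apply_symm_apply]
  rw [← card_pair hne]
  apply card_le_card
  intro y hy
  rw [mem_insert, mem_singleton] at hy
  rw [SimpleGraph.mem_neighborFinset]
  rcases hy with rfl | rfl
  · exact cycleFamily_adj_shift n hn x
  · have := cycleFamily_adj_shift n hn ((shift n).symm x)
    rw [Equiv.apply_symm_apply] at this
    exact this.symm

theorem connected_cycleFamily [Nonempty ι] (hn : ∀ i, 3 ≤ n i) : (cycleFamily n).Connected := by
  have h1 : ∀ (i : ι) (k : ℕ), (cycleFamily n).Reachable ⟨i, 0⟩ ⟨i, (k : ZMod (n i))⟩ := by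
    intro i k
    induction k with
    | zero => rw [Nat.cast_zero]
    | succ k ih =>
      refine ih.trans (SimpleGraph.Adj.reachable ?_)
      have := cycleFamily_adj_shift n hn ⟨i, (k : ZMod (n i))⟩
      simpa [shift] using this
  have h2 : ∀ i j : ι, (cycleFamily n).Reachable ⟨i, 0⟩ ⟨j, 0⟩ := by
    intro i j
    by_cases h : i = j
    · rw [h]
    · apply SimpleGraph.Adj.reachable
      rw [cycleFamily, SimpleGraph.fromRel_adj]
      exact ⟨fun h' => h (congrArg Sigma.fst h'), Or.inl (Or.inr ⟨rfl, rfl⟩)⟩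
  have h3 : ∀ x : Σ i, ZMod (n i), (cycleFamily n).Reachable ⟨x.1, 0⟩ x := by
    rintro ⟨i, a⟩
    have : NeZero (n i) := ⟨by have := hn i; omega⟩
    simpa using h1 i a.val
  have : Nonempty (Σ i, ZMod (n i)) := ⟨⟨Classical.arbitrary ι, 0⟩⟩
  exact ⟨fun x y => (h3 x).symm.trans ((h2 x.1 y.1).trans (h3 y))⟩

theorem exists_prod_le_period [Fintype ι] [Nonempty ι] (hn : ∀ i, 3 ≤ n i)
    (hcop : Pairwise (Function.onFun Nat.Coprime n)) :
    ∃ (sys : System) (S0 : State sys.G),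
      Fintype.card sys.V = ∑ i, n i ∧
      (∑ v : sys.V, S0.tokens v) = 2 * sys.G.edgeFinset.card ∧
      ∏ i, n i ≤ period sys.G sys.ord S0 := by
  classical
  have hne : ∀ i, NeZero (n i) := fun i => ⟨by have := hn i; omega⟩
  have hdeg : ∀ x, 2 ≤ (cycleFamily n).degree x := fun x => two_le_degree_cycleFamily n hn x
  have hσ := cycleFamily_adj_shift n hn
  obtain ⟨ord, hord⟩ := exists_ord_zero (cycleFamily n) (shift n) hσ
    fun v => two_pos.trans_le (hdeg v)
  let f : (Σ i, ZMod (n i)) → ℕ := fun x => if x.2 = 0 then 1 else 0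
  have hf : ∀ x, f x ≤ 1 := fun x => by simp only [f]; split_ifs <;> simp
  refine ⟨⟨Σ i, ZMod (n i), cycleFamily n, connected_cycleFamily n hn, ord⟩,
    rotState _ hdeg (shift n) f hf, ?_, sum_tokens_rotState _ _ _ _ _, ?_⟩
  · simp [Fintype.card_sigma, ZMod.card]
  · refine le_period_of_recurrent _ _ _ _ ⟨∏ i, n i, ?_, ?_⟩ fun p hp h => ?_
    · exact prod_pos fun i _ => Nat.pos_of_neZero _
    · rw [evol_rotState _ _ hdeg _ hord hσ]
      congr 1
      funext ⟨i, a⟩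
      have : ((∏ j, n j : ℕ) : ZMod (n i)) = 0 :=
        (ZMod.natCast_eq_zero_iff _ _).2 (dvd_prod_of_mem n (mem_univ i))
      rw [shift_symm_pow_apply, this, sub_zero]
    · rw [evol_rotState _ _ hdeg _ hord hσ] at h
      refine Nat.le_of_dvd hp (Fintype.prod_dvd_of_isRelPrime
        (fun i j hij => Nat.coprime_iff_isRelPrime.1 (hcop hij)) fun i => ?_)
      have h1 : f (((shift n).symm ^ p) (shift n ((shift n).symm ⟨i, 0⟩))) =
          f (shift n ((shift n).symm ⟨i, 0⟩)) := congrFun (congrArg State.ptr h) _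
      rw [Equiv.apply_symm_apply, shift_symm_pow_apply] at h1
      by_contra hdvd
      rw [← ZMod.natCast_eq_zero_iff] at hdvd
      simp [f, hdvd] at h1

end CycleFamily

open Filter Asymptotics Chebyshev in
theorem eventually_half_mul_le_theta : ∀ᶠ x : ℝ in atTop, x / 2 ≤ Chebyshev.theta x := by
  have h1 : ∀ᶠ x : ℝ in atTop, Real.log x ≤ (1 / 100) * √x := by
    have := (isLittleO_log_rpow_atTop (r := 1 / 2) (by norm_num)).bound
      (show (0 : ℝ) < 1 / 100 by norm_num)
    filter_upwards [this, eventually_ge_atTop 1] with x hx h1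
    rw [← Real.sqrt_eq_rpow, Real.norm_of_nonneg (Real.log_nonneg h1),
      Real.norm_of_nonneg (Real.sqrt_nonneg x)] at hx
    exact hx
  filter_upwards [h1, eventually_ge_atTop 100] with x hx hx100
  have hs : √x * √x = x := Real.mul_self_sqrt (by linarith)
  have hs10 : 10 ≤ √x := Real.le_sqrt_of_sq_le (by linarith)
  have hlog : Real.log (x + 2) ≤ Real.log x + 1 := by
    have : Real.log (x + 2) ≤ Real.log (x * 2) :=
      Real.log_le_log (by linarith) (by linarith)
    rw [Real.log_mul (by linarith) (by norm_num)] at this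
    linarith [Real.log_two_lt_d9]
  have := theta_ge' (x := x) (by linarith)
  have h2 := Real.log_two_gt_d9
  have h3 : 2 * √x * Real.log x ≤ 2 * √x * (1 / 100 * √x) := by gcongr
  have h4 : (x - 1) * 0.69 ≤ (x - 1) * Real.log 2 := by
    apply mul_le_mul_of_nonneg_left <;> linarith
  nlinarith

open Filter in
theorem exists_primes_sum_le_le_prod :
    ∃ c : ℝ, 0 < c ∧ ∃ n0 : ℕ, ∀ n : ℕ, n0 ≤ n → ∃ P : Finset ℕ,
      P.Nonempty ∧ (∀ p ∈ P, p.Prime ∧ 3 ≤ p) ∧ ∑ p ∈ P, p ≤ n ∧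
        (2 : ℝ) ^ (c * √((n : ℝ) * Real.log n)) ≤ ((∏ p ∈ P, p : ℕ) : ℝ) := by
  have hlog : Tendsto (fun n : ℕ => Real.log n) atTop atTop :=
    Real.tendsto_log_atTop.comp tendsto_natCast_atTop_atTop
  have hx : Tendsto (fun n : ℕ => √((n : ℝ) * Real.log n) / 3) atTop atTop :=
    (Real.tendsto_sqrt_atTop.comp
      (tendsto_natCast_atTop_atTop.atTop_mul_atTop₀ hlog)).atTop_div_const (by norm_num)
  refine ⟨1 / 12, by norm_num, ?_⟩
  obtain ⟨n0, hn0⟩ := eventually_atTop.1 <|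
    (hx.eventually eventually_half_mul_le_theta).and <|
    (hx.eventually (Chebyshev.eventually_primeCounting_le one_pos)).and <|
    (hx.eventually (eventually_ge_atTop 4)).and <|
    (hlog.eventually (eventually_ge_atTop 9)).and (eventually_ge_atTop 1)
  refine ⟨n0, fun n hn => ?_⟩
  obtain ⟨htheta, hpi, hx4, hlog9, hn1⟩ := hn0 n hn
  set s := √((n : ℝ) * Real.log n) with hs
  set x := s / 3 with hxs
  have hn1' : (1 : ℝ) ≤ n := by exact_mod_cast hn1
  have hss : s ^ 2 = n * Real.log n := Real.sq_sqrt (by positivity)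
  have hxsq : √(n : ℝ) ≤ x := by
    rw [hxs, le_div_iff₀ (by norm_num), hs, Real.sqrt_mul (by positivity)]
    gcongr
    exact Real.le_sqrt_of_sq_le (by linarith)
  have hlogx : Real.log n / 2 ≤ Real.log x := by
    rw [← Real.log_sqrt (by positivity)]
    exact Real.log_le_log (Real.sqrt_pos.2 (by linarith)) hxsq
  have hfl : 4 ≤ ⌊x⌋₊ := Nat.le_floor (by exact_mod_cast hx4)
  have h2mem : 2 ∈ Nat.primesLE ⌊x⌋₊ := by
    simp [Nat.mem_primesLE, Nat.prime_two]; omega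
  refine ⟨(Nat.primesLE ⌊x⌋₊).erase 2, ⟨3, ?_⟩, ?_, ?_, ?_⟩
  · simp [Nat.mem_primesLE, Nat.prime_three]; omega
  · intro p hp
    rw [mem_erase, Nat.mem_primesLE] at hp
    have := hp.2.2.two_le
    exact ⟨hp.2.2, by omega⟩
  · have h1 : ∑ p ∈ (Nat.primesLE ⌊x⌋₊).erase 2, p ≤ Nat.primeCounting ⌊x⌋₊ * ⌊x⌋₊ := by
      calc _ ≤ ∑ p ∈ Nat.primesLE ⌊x⌋₊, p := sum_le_sum_of_subset (erase_subset _ _)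
        _ ≤ ∑ p ∈ Nat.primesLE ⌊x⌋₊, ⌊x⌋₊ :=
          sum_le_sum fun p hp => (Nat.mem_primesLE.1 hp).1
        _ = _ := by simp
    have h2 : ((Nat.primeCounting ⌊x⌋₊ : ℕ) : ℝ) * (⌊x⌋₊ : ℕ) ≤ n := by
      have hl4 : Real.log 4 ≤ 2 := by
        have : Real.log 4 = 2 * Real.log 2 := by
          rw [show (4 : ℝ) = 2 ^ 2 by norm_num, Real.log_pow]; norm_num
        linarith [Real.log_two_lt_d9]
      have hL : 0 < Real.log x := by linarith
      calc ((Nat.primeCounting ⌊x⌋₊ : ℕ) : ℝ) * (⌊x⌋₊ : ℕ)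
          ≤ ((Real.log 4 + 1) * x / Real.log x) * x := by
            gcongr
            exact Nat.floor_le (by linarith)
        _ ≤ (3 * x / Real.log x) * x := by gcongr; linarith
        _ = 3 * x ^ 2 / Real.log x := by ring
        _ ≤ n := by
            rw [div_le_iff₀ hL, hxs, div_pow, hss]
            nlinarith
    exact h1.trans (by exact_mod_cast h2)
  · have hprod : 2 * ∏ p ∈ (Nat.primesLE ⌊x⌋₊).erase 2, p = primorial ⌊x⌋₊ := by
      rw [primorial_eq_prod_primesLE]
      exact mul_prod_erase _ (fun p => p) h2mem
    rw [Chebyshev.theta_eq_log_primorial, ← hprod] at htheta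
    set Q := ∏ p ∈ (Nat.primesLE ⌊x⌋₊).erase 2, p with hQ
    have hQ0 : (0 : ℝ) < Q := by
      have := primorial_pos ⌊x⌋₊
      rw [← hprod] at this
      exact_mod_cast Nat.pos_of_mul_pos_left this
    push_cast at htheta
    rw [Real.log_mul two_ne_zero hQ0.ne'] at htheta
    rw [Real.rpow_def_of_pos two_pos, ← Real.le_log_iff_exp_le hQ0]
    have := Real.log_two_lt_d9
    have hs0 : 0 ≤ s := Real.sqrt_nonneg _
    nlinarith [mul_le_mul_of_nonneg_right this.le hs0]

/-- There are constants `c > 0` and `n₀` such that for every `n ≥ n₀`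
there is a rotor-router system on a finite connected graph with at most `n` vertices and
`m` edges, and an initial state carrying `k = 2m` tokens, whose periodicity is at least
`2^(c·√(n·log n))`. -/
theorem exists_superpolynomial_period :
    ∃ c : ℝ, 0 < c ∧ ∃ n0 : ℕ, ∀ n : ℕ, n0 ≤ n →
      ∃ (sys : System) (S0 : State sys.G),
        Fintype.card sys.V ≤ n ∧
        (∑ v : sys.V, S0.tokens v) = 2 * sys.G.edgeFinset.card ∧
        (2 : ℝ) ^ (c * Real.sqrt ((n : ℝ) * Real.log (n : ℝ))) ≤
          (period sys.G sys.ord S0 : ℝ) := by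
  obtain ⟨c, hc, n0, h⟩ := exists_primes_sum_le_le_prod
  refine ⟨c, hc, n0, fun n hn => ?_⟩
  obtain ⟨P, hPne, hP, hsum, hprod⟩ := h n hn
  have : Nonempty P := hPne.to_subtype
  obtain ⟨sys, S0, hcard, htok, hper⟩ := exists_prod_le_period (fun p : P => (p : ℕ))
    (fun p => (hP p p.2).2)
    (fun p q hpq => (Nat.coprime_primes (hP p p.2).1 (hP q q.2).1).2 (Subtype.coe_injective.ne hpq))
  rw [sum_coe_sort P fun p => p] at hcard
  rw [prod_coe_sort P fun p => p] at hper
  exact ⟨sys, S0, hcard.trans_le hsum, htok, hprod.trans (by exact_mod_cast hper)⟩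

end RotorRouter
end

section
/- In any rotor-router execution, for every vertex v, every two outgoing arcs e_1, e_2 ∈ out(v), and all times t_1 ≤ t_2, the cumulative loads satisfy |C_{t_1}^{t_2}(e_1) − C_{t_1}^{t_2}(e_2)| ≤ 1. -/
open Finset

namespace RotorRouter

variable {V : Type} [Fintype V] [DecidableEq V] (G : SimpleGraph V) [DecidableRel G.Adj]

variable (ord : ∀ v : V, Fin (G.degree v) ≃ {d : G.Dart // d.fst = v})

theorem sentCount_add_ite {deg p j : ℕ} (hp : p < deg) (hj : j < deg) (k : ℕ) :
    sentCount deg p k j + (if j < p then 1 else 0) =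
      (p + k) / deg + if j < (p + k) % deg then 1 else 0 := by
  have hdeg : 0 < deg := by omega
  have h := Nat.count_add (fun i => i ≡ j [MOD deg]) p k
  rw [Nat.count_modEq_card _ hdeg, Nat.count_modEq_card _ hdeg,
    Nat.count_eq_card_filter_range] at h
  simp only [Nat.ModEq, Nat.mod_eq_of_lt hp, Nat.mod_eq_of_lt hj, Nat.div_eq_of_lt hp] at h
  rw [sentCount]
  omega

theorem abs_sentCount_sub_le_one {deg p i j : ℕ} (hp : p < deg) (hi : i < deg) (hj : j < deg)
    (k : ℕ) : |(sentCount deg p k i : ℤ) - sentCount deg p k j| ≤ 1 := by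
  have h1 := sentCount_add_ite hp hi k
  have h2 := sentCount_add_ite hp hj k
  rw [abs_le]
  split_ifs at h1 h2 <;> omega

theorem sentCount_add (deg p k l j : ℕ) :
    sentCount deg p (k + l) j = sentCount deg p k j + sentCount deg ((p + k) % deg) l j := by
  simp only [sentCount, ← Nat.count_eq_card_filter_range, Nat.count_add, Nat.mod_add_mod,
    add_assoc]

theorem evol_succ (S0 : State G) (t : ℕ) :
    evol G ord S0 (t + 1) = step G ord (evol G ord S0 t) :=
  Function.iterate_succ_apply' _ _ _

theorem ptr_evol_eq (S0 : State G) {v : V} (hv : 0 < G.degree v) {t1 t2 : ℕ} (ht : t1 ≤ t2) :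
    (evol G ord S0 t2).ptr v =
      ((evol G ord S0 t1).ptr v + cumV G ord S0 t1 t2 v) % G.degree v := by
  induction t2, ht using Nat.le_induction with
  | base => simp [cumV, Nat.mod_eq_of_lt ((evol G ord S0 t1).ptr_lt v hv)]
  | succ t ht ih =>
    rw [evol_succ, cumV, Finset.sum_Ico_succ_top ht, ← cumV]
    simp only [step, if_pos hv]
    rw [ih, Nat.mod_add_mod, add_assoc]

/-- The cumulative load of an arc is that of a single round-robin emission of all the tokens
that leave its tail. -/
theorem cum_eq_sentCount (S0 : State G) (d : G.Dart) {t1 t2 : ℕ} (ht : t1 ≤ t2) :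
    cum G ord S0 t1 t2 d =
      sentCount (G.degree d.fst) ((evol G ord S0 t1).ptr d.fst) (cumV G ord S0 t1 t2 d.fst)
        ((ord d.fst).symm ⟨d, rfl⟩ : Fin (G.degree d.fst)) := by
  induction t2, ht using Nat.le_induction with
  | base => simp [cum, cumV, sentCount]
  | succ t ht ih =>
    have hd : 0 < G.degree d.fst := ((ord d.fst).symm ⟨d, rfl⟩).pos
    rw [cum, Finset.sum_Ico_succ_top ht, ← cum, cumV, Finset.sum_Ico_succ_top ht, ← cumV,
      sentCount_add, ih, load, arcLoad, ptr_evol_eq G ord S0 hd ht]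

/-- In any rotor-router execution, for every vertex `v`, any two
outgoing arcs `e₁, e₂ ∈ out(v)` and all times `t₁ ≤ t₂`, the cumulative loads satisfy
`|C_{t₁}^{t₂}(e₁) − C_{t₁}^{t₂}(e₂)| ≤ 1`. -/
theorem cumulative_outgoing_discrepancy_le_one (hconn : G.Connected) (S0 : State G)
    (v : V) (e1 e2 : G.Dart) (he1 : e1 ∈ outArcs G v) (he2 : e2 ∈ outArcs G v)
    (t1 t2 : ℕ) (ht : t1 ≤ t2) :
    |(cum G ord S0 t1 t2 e1 : ℤ) - (cum G ord S0 t1 t2 e2 : ℤ)| ≤ 1 := by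
  obtain rfl : e1.fst = v := by simpa [outArcs] using he1
  have h2 : e2.fst = e1.fst := by simpa [outArcs] using he2
  have hj := ((ord e2.fst).symm ⟨e2, rfl⟩).isLt
  rw [cum_eq_sentCount G ord S0 e1 ht, cum_eq_sentCount G ord S0 e2 ht]
  generalize (((ord e2.fst).symm ⟨e2, rfl⟩ : Fin (G.degree e2.fst)) : ℕ) = j at hj ⊢
  rw [h2] at hj ⊢
  exact abs_sentCount_sub_le_one ((evol G ord S0 t1).ptr_lt _ (by omega)) (Fin.isLt _) hj _

end RotorRouter
end
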